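/- Let G be a finite nilpotent group, F an abelian number field, and χ a complex irreducible character of G. If the Schur index of χ over F is greater than 1, then it equals 2, and the division algebra part of the corresponding simple component of F(χ)G is a quaternion division algebra. -/

import Mathlib

open scoped TensorProduct

/-- `A` is the cyclic algebra `(L/K, σ, a)`. -/
def IsCyclicAlgebra (K : Type*) [Field K] (L : Type*) [Field L] [Algebra K L]
    (σ : L ≃ₐ[K] L) (a : L) (A : Type*) [Ring A] [Algebra K A] : Prop :=
  ∃ (ι : L →ₐ[K] A) (u : Aˣ),
    (u : A) ^ Module.finrank K L = ι a ∧
    (∀ x : L, (u : A) * ι x = ι (σ x) * (u : A)) ∧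
    Function.Bijective fun f : Fin (Module.finrank K L) → L =>
      ∑ i, ι (f i) * (u : A) ^ (i : ℕ)

/-- The Schur index of a central simple `K`-algebra. -/
noncomputable def schurIndex (K A : Type*) [Field K] [Ring A] [Algebra K A] : ℕ :=
  sInf {m | ∃ (D : Type) (_ : DivisionRing D) (_ : Algebra K D) (r : ℕ),
      Nonempty (A ≃ₐ[K] Matrix (Fin r) (Fin r) D) ∧ m * m = Module.finrank K D}

/-- Local index at a real embedding. -/
noncomputable def realLocalIndex (K A : Type*) [Field K] [Ring A] [Algebra K A]
    (φ : K →+* ℝ) : ℕ :=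
  letI := φ.toAlgebra
  schurIndex ℝ (ℝ ⊗[K] A)

def IsBrauerEquiv (K A B : Type*) [Field K] [Ring A] [Algebra K A] [Ring B] [Algebra K B] :
    Prop :=
  ∃ r s : ℕ, 0 < r ∧ 0 < s ∧
    Nonempty (Matrix (Fin r) (Fin r) A ≃ₐ[K] Matrix (Fin s) (Fin s) B)

/-- The simple component `Re` of `R`, realized as `R/(1-e)`. -/
abbrev simpleComponent (R : Type*) [Ring R] (e : R) : Type _ :=
  (TwoSidedIdeal.span {1 - e}).ringCon.Quotient

noncomputable instance (F R : Type*) [CommSemiring F] [Ring R] [Algebra F R] (e : R) :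
    Algebra F (simpleComponent R e) :=
  RingHom.toAlgebra' ((TwoSidedIdeal.span {1 - e}).ringCon.mk'.comp (algebraMap F R)) <| by
    intro c x
    induction x using Quotient.inductionOn' with
    | h x =>
        show ((algebraMap F R c : R) : simpleComponent R e) * (x : simpleComponent R e)
          = (x : simpleComponent R e) * ((algebraMap F R c : R) : simpleComponent R e)
        rw [← RingCon.coe_mul, ← RingCon.coe_mul, Algebra.commutes]

/-- `e` is a centrally primitive idempotent. -/
def IsCentrallyPrimitiveIdempotent (R : Type*) [Ring R] (e : R) : Prop :=
  e ∈ Subring.center R ∧ e * e = e ∧ e ≠ 0 ∧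
    ∀ a b : R, a ∈ Subring.center R → b ∈ Subring.center R → a * a = a → b * b = b →
      a * b = 0 → e = a + b → a = 0 ∨ b = 0

theorem int_isCoprime_of_forall_prime {a b : ℤ}
    (h : ∀ q : ℕ, q.Prime → (q : ℤ) ∣ a → ¬ (q : ℤ) ∣ b) : IsCoprime a b := by
  rw [Int.isCoprime_iff_nat_coprime]
  refine Nat.Coprime.symm (Nat.coprime_of_dvd fun q hq h1 h2 => h q hq ?_ ?_)
  · exact Int.natCast_dvd.2 h2
  · exact Int.natCast_dvd.2 h1

theorem geom_sum_modEq_of_dvd_sub_one {s q : ℤ} (h : q ∣ s - 1) (p : ℕ) :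
    q ∣ (∑ i ∈ Finset.range p, s ^ i) - p := by
  have : (∑ i ∈ Finset.range p, s ^ i) - p = ∑ i ∈ Finset.range p, (s ^ i - 1) := by simp
  rw [this]
  exact Finset.dvd_sum fun i _ => h.trans (sub_one_dvd_pow_sub_one s i)

theorem geom_sum_eq_prime_mul_coprime {n p : ℕ} (hn : n ≠ 0) (hp : p.Prime) {s : ℤ}
    (hs : (n : ℤ) ∣ s ^ p - 1) (hs1 : ¬ (n : ℤ) ∣ s - 1)
    (hq : ∀ q : ℕ, q.Prime → q ∣ n → (q : ℤ) ∣ s - 1)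
    (h4 : 4 ∣ n → (4 : ℤ) ∣ s - 1) :
    p ∣ n ∧ (n : ℤ) ∣ p * (s - 1) ∧
      ∃ u : ℤ, ∑ i ∈ Finset.range p, s ^ i = p * u ∧ IsCoprime u n := by
  have hmul : (n : ℤ) ∣ (∑ i ∈ Finset.range p, s ^ i) * (s - 1) := by rwa [geom_sum_mul]
  have key : ∀ q : ℕ, q.Prime → q ∣ n → (q : ℤ) ∣ ∑ i ∈ Finset.range p, s ^ i → q = p := by
    intro q hqp hqn hd
    have := geom_sum_modEq_of_dvd_sub_one (hq q hqp hqn) p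
    have h1 : (q : ℤ) ∣ p := by
      have := dvd_sub hd this
      simpa using this
    exact (Nat.prime_dvd_prime_iff_eq hqp hp).1 (by exact_mod_cast h1)
  have hpn : p ∣ n := by
    by_contra hpn
    apply hs1
    refine IsCoprime.dvd_of_dvd_mul_left (IsCoprime.symm ?_) hmul
    refine int_isCoprime_of_forall_prime fun q hqp h1 h2 => ?_
    have h2 : q ∣ n := by exact_mod_cast h2
    exact hpn (key q hqp h2 h1 ▸ h2)
  have hps := hq p hp hpn
  have hpS : (p : ℤ) ∣ ∑ i ∈ Finset.range p, s ^ i := by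
    have := dvd_add (geom_sum_modEq_of_dvd_sub_one hps p) (dvd_refl (p : ℤ))
    simpa using this
  obtain ⟨u, hu⟩ := hpS
  have hcop : IsCoprime u (n : ℤ) := by
    refine int_isCoprime_of_forall_prime fun q hqp h1 h2 => ?_
    have h2 : q ∣ n := by exact_mod_cast h2
    obtain rfl := key q hqp h2 (hu ▸ h1.mul_left _)
    obtain ⟨v, rfl⟩ := h1
    rcases hqp.eq_two_or_odd' with rfl | hodd
    · simp [Finset.sum_range_succ] at hu
      by_cases h4n : 4 ∣ n
      · have := h4 h4n
        omega
      · obtain ⟨k, rfl⟩ := h2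
        have hk : ¬ 2 ∣ k := by omega
        apply hs1
        have hks : (k : ℤ) ∣ s - 1 := by
          refine IsCoprime.dvd_of_dvd_mul_left (y := s + 1) ?_ ?_
          · refine (int_isCoprime_of_forall_prime fun q hqp h1 h2 => ?_).symm
            have h2 : q ∣ k := by exact_mod_cast h2
            have h3 := hq q hqp (h2.mul_left 2)
            have h5 : (q : ℤ) ∣ (2 : ℕ) := by
              have := dvd_sub h1 h3
              ring_nf at this
              simpa using this
            have := (Nat.prime_dvd_prime_iff_eq hqp hp).1 (by exact_mod_cast h5)
            exact hk (this ▸ h2)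
          · have hdvd : (k : ℤ) ∣ ((2 * k : ℕ) : ℤ) := ⟨2, by push_cast; ring⟩
            refine hdvd.trans (hmul.trans (dvd_of_eq ?_))
            rw [Finset.sum_range_succ, Finset.sum_range_one, pow_zero, pow_one, add_comm]
        push_cast
        refine IsCoprime.mul_dvd ?_ (by simpa using hps) hks
        have : Nat.Coprime 2 k := (Nat.Prime.coprime_iff_not_dvd Nat.prime_two).2 hk
        exact_mod_cast Nat.isCoprime_iff_coprime.2 this
    · obtain ⟨t, ht⟩ := hps
      have := odd_sq_dvd_geom_sum₂_sub (R := ℤ) (a := 1) (b := t) hodd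
      rw [show (1 + q * t : ℤ) = s by linarith] at this
      simp only [one_pow, mul_one, hu] at this
      have h3 : (q : ℤ) ^ 2 ∣ q := by
        have := dvd_sub (show (q : ℤ) ^ 2 ∣ q * (q * v) from ⟨v, by ring⟩) this
        simpa using this
      have h4 : q ^ 2 ∣ q := by exact_mod_cast h3
      have := Nat.le_of_dvd hqp.pos h4
      nlinarith [hqp.two_le]
  refine ⟨hpn, ?_, u, hu, hcop⟩
  refine IsCoprime.dvd_of_dvd_mul_left hcop.symm (hmul.trans (dvd_of_eq ?_))
  rw [hu]; ring

section Group

open Subgroup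

variable {G : Type*} [Group G]

theorem exists_mem_notMem_forall_commutator_mem [Group.IsNilpotent G] {N H : Subgroup G}
    [H.Normal] (h : ¬ H ≤ N) :
    ∃ x ∈ H, x ∉ N ∧ ∀ g : G, g * x * g⁻¹ * x⁻¹ ∈ N := by
  classical
  obtain ⟨n, hn⟩ := (Subgroup.nilpotent_iff_lowerCentralSeries (G := G)).1 inferInstance
  have hex : ∃ i, H ⊓ (⊤ : Subgroup G).lowerCentralSeries i ≤ N := ⟨n, by simp [hn]⟩
  have h0 : Nat.find hex ≠ 0 := fun h0 => h (by simpa [h0] using Nat.find_spec hex)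
  obtain ⟨i, hi⟩ := Nat.exists_eq_succ_of_ne_zero h0
  have h1 := Nat.find_spec hex
  rw [hi] at h1
  obtain ⟨x, ⟨hxH, hxL⟩, hxN⟩ := SetLike.not_le_iff_exists.1 (Nat.find_min hex (m := i) (by omega))
  refine ⟨x, hxH, hxN, fun g => h1 ⟨?_, ?_⟩⟩
  · exact H.mul_mem (Normal.conj_mem ‹_› x hxH g) (H.inv_mem hxH)
  · have := Subgroup.commutator_mem_commutator hxL (mem_top g)
    rw [← Subgroup.lowerCentralSeries_succ] at this
    have := inv_mem this
    simpa [commutatorElement_def, mul_assoc] using this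

theorem exists_prime_pow_mem_forall_commutator_mem [Finite G] [Group.IsNilpotent G]
    {N H : Subgroup G} [N.Normal] [H.Normal] (h : ¬ H ≤ N) :
    ∃ x ∈ H, x ∉ N ∧ (∀ g : G, g * x * g⁻¹ * x⁻¹ ∈ N) ∧ ∃ p : ℕ, p.Prime ∧ x ^ p ∈ N := by
  obtain ⟨x, hxH, hxN, hx⟩ := exists_mem_notMem_forall_commutator_mem h
  have hcomm : ∀ (k : ℕ) (g : G), g * x ^ k * g⁻¹ * (x ^ k)⁻¹ ∈ N := by
    intro k g
    rw [← conj_pow, ← div_eq_mul_inv, ← QuotientGroup.eq_iff_div_mem, QuotientGroup.mk_pow,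
      QuotientGroup.mk_pow, QuotientGroup.eq_iff_div_mem.2 (by simpa [div_eq_mul_inv] using hx g)]
  have hord : orderOf (x : G ⧸ N) ≠ 1 := by
    rw [Ne, orderOf_eq_one_iff, QuotientGroup.eq_one_iff]; exact hxN
  obtain ⟨p, hp, k, hk⟩ := Nat.exists_prime_and_dvd hord
  refine ⟨x ^ k, pow_mem hxH k, fun hmem => ?_, hcomm k, p, hp, ?_⟩
  · rw [← QuotientGroup.eq_one_iff, QuotientGroup.mk_pow, ← orderOf_dvd_iff_pow_eq_one, hk] at hmem
    have hpos : 0 < p * k := hk ▸ orderOf_pos _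
    have hk0 : 0 < k := Nat.pos_of_mul_pos_left hpos
    have := Nat.le_of_dvd hk0 hmem
    nlinarith [hp.two_le]
  · rw [← QuotientGroup.eq_one_iff, QuotientGroup.mk_pow, QuotientGroup.mk_pow, ← pow_mul,
      mul_comm, ← hk, pow_orderOf_eq_one]

theorem mul_pow_eq_zpow_geom_sum_mul {z x : G} {s : ℤ} (h : x * z * x⁻¹ = z ^ s) (k : ℕ) :
    (z * x) ^ k = z ^ (∑ i ∈ Finset.range k, s ^ i) * x ^ k := by
  induction k with
  | zero => simp
  | succ k ih =>
    have h2 : x * z ^ (∑ i ∈ Finset.range k, s ^ i) =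
        z ^ (s * ∑ i ∈ Finset.range k, s ^ i) * x := by
      rw [zpow_mul, ← h, conj_zpow]; group
    rw [pow_succ', ih, geom_sum_succ, add_comm, zpow_add, zpow_one, pow_succ', mul_assoc z x,
      ← mul_assoc x, h2]
    simp only [mul_assoc]

theorem exists_normal_comm_of_conj_mem {S : Set G} (hS : ∀ g : G, ∀ w ∈ S, g * w * g⁻¹ ∈ S)
    (hcomm : ∀ x ∈ S, ∀ y ∈ S, x * y = y * x) :
    ∃ E : Subgroup G, E.Normal ∧ (∀ x ∈ E, ∀ y ∈ E, x * y = y * x) ∧ S ⊆ E := by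
  have hconj : Group.conjugatesOfSet S = S := by
    refine Set.Subset.antisymm (fun x hx => ?_) Group.subset_conjugatesOfSet
    obtain ⟨a, ha, hax⟩ := Group.mem_conjugatesOfSet_iff.1 hx
    obtain ⟨c, rfl⟩ := isConj_iff.1 hax
    exact hS c a ha
  have hn : (closure S).Normal := by
    have : (normalClosure S).Normal := inferInstance
    rwa [normalClosure, hconj] at this
  have := Subgroup.isMulCommutative_closure hcomm
  exact ⟨closure S, hn, fun x hx y hy => setLike_mul_comm hx hy, subset_closure⟩

theorem exists_normal_comm_centralizer_le [Finite G] [Group.IsNilpotent G] :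
    ∃ N : Subgroup G, N.Normal ∧ (∀ x ∈ N, ∀ y ∈ N, x * y = y * x) ∧
      centralizer (N : Set G) ≤ N := by
  obtain ⟨N, -, ⟨hN, hNc⟩, hmax⟩ := Set.Finite.exists_le_maximal
    (s := {N : Subgroup G | N.Normal ∧ ∀ x ∈ N, ∀ y ∈ N, x * y = y * x}) (a := ⊥)
    (Set.toFinite _) ⟨inferInstance, by simp⟩
  refine ⟨N, hN, hNc, ?_⟩
  by_contra hle
  obtain ⟨x, hxC, hxN, hx⟩ := exists_mem_notMem_forall_commutator_mem hle
  have hxz : ∀ z ∈ N, z * x = x * z := mem_centralizer_iff.1 hxC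
  obtain ⟨E, hE, hEc, hSE⟩ := exists_normal_comm_of_conj_mem
    (S := {w : G | ∃ z ∈ N, w = z ∨ w = z * x}) (by
      rintro g w ⟨z, hz, rfl | rfl⟩
      · exact ⟨_, hN.conj_mem _ hz g, Or.inl rfl⟩
      · exact ⟨_, mul_mem (hN.conj_mem _ hz g) (hx g), Or.inr (by group)⟩) (by
      rintro _ ⟨z, hz, rfl | rfl⟩ _ ⟨w, hw, rfl | rfl⟩
      · exact hNc _ hz _ hw
      · rw [← mul_assoc, hNc _ hz _ hw, mul_assoc, hxz _ hz, mul_assoc]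
      · rw [mul_assoc, ← hxz _ hw, ← mul_assoc, hNc _ hz _ hw, mul_assoc]
      · rw [mul_assoc, ← mul_assoc x, ← hxz _ hw, mul_assoc w, ← mul_assoc, hNc _ hz _ hw,
          mul_assoc w x, ← mul_assoc x z, ← hxz _ hz]
        simp only [mul_assoc])
  exact hxN (hmax ⟨hE, hEc⟩ (fun z hz => hSE ⟨z, hz, Or.inl rfl⟩)
    (hSE ⟨1, one_mem _, Or.inr (one_mul x).symm⟩))

/-- A nilpotent group acts on the roots of unity of prime order of a cyclic normal subgroup
trivially. -/
theorem dvd_sub_one_of_conj_eq_zpow [Group.IsNilpotent G] {c x : G} {s : ℤ} {q : ℕ}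
    (hq : q.Prime) (hN : (zpowers c).Normal) (hc : orderOf c = q) (hs : x * c * x⁻¹ = c ^ s) :
    (q : ℤ) ∣ s - 1 := by
  have hc1 : c ≠ 1 := fun h => hq.one_lt.ne (by rw [← hc, h, orderOf_one])
  obtain ⟨y, hy, hy1, hyc⟩ := exists_mem_notMem_forall_commutator_mem
    (N := (⊥ : Subgroup G)) (H := zpowers c) (by simpa using hc1)
  obtain ⟨k, rfl⟩ := mem_zpowers_iff.1 hy
  have h1 := hyc x
  rw [mem_bot, ← conj_zpow, hs, ← zpow_mul, ← zpow_neg, ← zpow_add,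
    ← orderOf_dvd_iff_zpow_eq_one, hc, show s * k + -k = (s - 1) * k by ring] at h1
  refine (Int.Prime.dvd_mul' hq h1).resolve_right fun h2 => hy1 ?_
  rwa [mem_bot, ← orderOf_dvd_iff_zpow_eq_one, hc]

theorem mem_zpowers_of_pow_prime_eq_one [Finite G] [IsCyclic G] {p : ℕ} (hp : p.Prime) {y z : G}
    (hz : orderOf z = p) (hy : y ^ p = 1) : y ∈ zpowers z := by
  classical
  have := Fintype.ofFinite G
  have hcard := IsCyclic.card_pow_eq_one_le (α := G) hp.pos
  have hsub : (zpowers z : Set G).toFinset ⊆ Finset.univ.filter fun a : G => a ^ p = 1 := by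
    intro a ha
    obtain ⟨k, rfl⟩ := mem_zpowers_iff.1 (by simpa using ha)
    simp only [Finset.mem_filter, Finset.mem_univ, true_and]
    rw [← zpow_natCast, ← zpow_mul, mul_comm, zpow_mul, zpow_natCast, ← hz, pow_orderOf_eq_one,
      one_zpow]
  have heq := Finset.eq_of_subset_of_card_le hsub (by
    rw [Set.toFinset_card]
    refine hcard.trans (le_of_eq ?_)
    rw [← hz]
    exact (Fintype.card_zpowers).symm)
  have : y ∈ (zpowers z : Set G).toFinset := by
    rw [heq]; simpa using hy
  simpa using this

theorem mem_of_centralizes_four_torsion [Finite G] [Group.IsNilpotent G]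
    (h : ∀ N : Subgroup G, N.Normal → (∀ x ∈ N, ∀ y ∈ N, x * y = y * x) → IsCyclic N)
    {c : G} (hN : (zpowers c).Normal) (hC : centralizer (zpowers c : Set G) ≤ zpowers c)
    {x : G} (hx : ∀ g : G, g * x * g⁻¹ * x⁻¹ ∈ zpowers c) {p : ℕ} (hp : p.Prime)
    (hxp : x ^ p ∈ zpowers c)
    (h4 : 4 ∣ orderOf c → Commute x (c ^ (orderOf c / 4))) : x ∈ zpowers c := by
  by_contra hxN
  set n := orderOf c with hn
  have hn0 : n ≠ 0 := (orderOf_pos c).ne'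
  have hdvd : ∀ a : ℤ, c ^ a = 1 ↔ (n : ℤ) ∣ a := fun a => orderOf_dvd_iff_zpow_eq_one.symm
  have hnc : ∀ d : ℕ, (zpowers (c ^ d)).Normal := by
    intro d
    refine ⟨fun z hz g => ?_⟩
    obtain ⟨k, rfl⟩ := mem_zpowers_iff.1 hz
    obtain ⟨s, hs⟩ := mem_zpowers_iff.1 (hN.conj_mem c (mem_zpowers c) g)
    rw [← conj_zpow, ← conj_pow, ← hs, ← zpow_natCast (c ^ s), zpow_comm c,
      zpow_natCast]
    exact zpow_mem (zpow_mem (mem_zpowers _) _) _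
  have hord : ∀ d : ℕ, d ∣ n → orderOf (c ^ (n / d)) = d := by
    intro d hd
    rw [orderOf_pow_of_dvd (Nat.div_pos (Nat.le_of_dvd (Nat.pos_of_ne_zero hn0) hd)
      (Nat.pos_of_dvd_of_pos hd (Nat.pos_of_ne_zero hn0))).ne' (Nat.div_dvd_of_dvd hd), ← hn,
      Nat.div_div_self hd hn0]
  obtain ⟨s, hs⟩ := mem_zpowers_iff.1 (hN.conj_mem c (mem_zpowers c) x)
  have hconj : ∀ a : ℤ, x * c ^ a * x⁻¹ = c ^ (s * a) := fun a => by
    rw [← conj_zpow, ← hs, zpow_mul]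
  have hfix : ∀ a : ℤ, Commute x (c ^ a) ↔ (n : ℤ) ∣ a * (s - 1) := by
    intro a
    rw [commute_iff_eq, ← mul_inv_eq_iff_eq_mul, hconj, ← div_eq_one, div_eq_mul_inv, ← zpow_neg,
      ← zpow_add, hdvd, show s * a + -a = a * (s - 1) by ring]
  have hsp : (n : ℤ) ∣ s ^ p - 1 := by
    have hk : ∀ k : ℕ, x ^ k * c * (x ^ k)⁻¹ = c ^ (s ^ k) := by
      intro k
      induction k with
      | zero => simp
      | succ k ih => rw [pow_succ' s, ← hconj, ← ih]; group
    have h1 : x ^ p * c * (x ^ p)⁻¹ = c := by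
      obtain ⟨j, hj⟩ := mem_zpowers_iff.1 hxp
      rw [← hj]; group
    rw [hk] at h1
    rw [← hdvd, zpow_sub, h1, zpow_one, mul_inv_cancel]
  have hs1 : ¬ (n : ℤ) ∣ s - 1 := by
    intro hd
    refine hxN (hC (mem_centralizer_iff.2 fun z hz => ?_))
    obtain ⟨k, rfl⟩ := mem_zpowers_iff.1 hz
    exact ((hfix k).2 (hd.mul_left k)).eq.symm
  have hq : ∀ q : ℕ, q.Prime → q ∣ n → (q : ℤ) ∣ s - 1 := by
    intro q hq hqn
    refine dvd_sub_one_of_conj_eq_zpow (x := x) hq (hnc (n / q)) (hord q hqn) ?_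
    rw [← zpow_natCast c, hconj, mul_comm, zpow_mul]
  obtain ⟨hpn, hps, u, hu, hcop⟩ := geom_sum_eq_prime_mul_coprime hn0 hp hsp hs1 hq (by
    rintro ⟨k, hk⟩
    have h1 := h4 ⟨k, hk⟩
    rw [← zpow_natCast, hfix, hk, Nat.mul_div_cancel_left _ (by norm_num)] at h1
    have hk0 : (k : ℤ) ≠ 0 := by
      rintro h0
      exact hn0 (by rw [hk, Int.natCast_eq_zero.1 h0])
    refine Int.dvd_of_mul_dvd_mul_left hk0 ?_
    refine dvd_trans (dvd_of_eq ?_) h1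
    push_cast; ring)
  obtain ⟨j, hj⟩ := mem_zpowers_iff.1 hxp
  have hpj : (p : ℤ) ∣ j := by
    by_contra hpj
    have h1 : (n : ℤ) ∣ j * (s - 1) := by
      rw [← hfix, hj]; exact (Commute.refl x).pow_right p
    obtain ⟨a, b, hab⟩ :=
      (Nat.prime_iff_prime_int.1 hp).coprime_iff_not_dvd.2 hpj
    apply hs1
    have : s - 1 = a * (p * (s - 1)) + b * (j * (s - 1)) := by
      linear_combination (-(s - 1)) * hab
    rw [this]
    exact dvd_add (hps.mul_left a) (h1.mul_left b)
  obtain ⟨j, rfl⟩ := hpj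
  obtain ⟨v, w, hvw⟩ := hcop
  obtain ⟨y, hyp, hyN, hyc, hyx⟩ : ∃ y : G, y ^ p = 1 ∧ y ∉ zpowers c ∧
      (∀ g : G, g * y * g⁻¹ * y⁻¹ ∈ zpowers c) ∧ ∀ a : ℤ, y * c ^ a * y⁻¹ = x * c ^ a * x⁻¹ := by
    refine ⟨c ^ (-j * v) * x, ?_, ?_, fun g => ?_, fun a => ?_⟩
    · have : x * c ^ (-j * v) * x⁻¹ = (c ^ (-j * v)) ^ s := by rw [hconj, mul_comm, zpow_mul]
      rw [mul_pow_eq_zpow_geom_sum_mul this, hu, ← hj, ← zpow_mul, ← zpow_add, hdvd]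
      exact ⟨p * j * w, by linear_combination (-(p * j)) * hvw⟩
    · rwa [mul_mem_cancel_left (zpow_mem (mem_zpowers c) _)]
    · have h1 : g * (c ^ (-j * v) * x) * g⁻¹ * (c ^ (-j * v) * x)⁻¹ =
          g * c ^ (-j * v) * g⁻¹ * (g * x * g⁻¹ * x⁻¹) * (c ^ (-j * v))⁻¹ := by group
      rw [h1]
      exact mul_mem (mul_mem (hN.conj_mem _ (zpow_mem (mem_zpowers c) _) g) (hx g))
        (inv_mem (zpow_mem (mem_zpowers c) _))
    · have h1 : c ^ (-j * v) * x * c ^ a * (c ^ (-j * v) * x)⁻¹ =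
          c ^ (-j * v) * (x * c ^ a * x⁻¹) * (c ^ (-j * v))⁻¹ := by group
      rw [h1, hconj, zpow_mul_comm, mul_inv_cancel_right]
  have htors : ∀ z ∈ zpowers c, z ^ p = 1 → y * z = z * y := by
    intro z hz hzp
    obtain ⟨k, rfl⟩ := mem_zpowers_iff.1 hz
    rw [← mul_inv_eq_iff_eq_mul, hyx, mul_inv_eq_iff_eq_mul]
    refine ((hfix k).2 ?_).eq
    rw [← zpow_natCast, ← zpow_mul, hdvd] at hzp
    exact hzp.trans (mul_dvd_mul_left k (hq p hp hpn))
  have hcN : ∀ z ∈ zpowers c, ∀ w ∈ zpowers c, z * w = w * z := fun z hz w hw =>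
    setLike_mul_comm hz hw
  obtain ⟨E, hE, hEc, hSE⟩ := exists_normal_comm_of_conj_mem
    (S := {w : G | ∃ z ∈ zpowers c, z ^ p = 1 ∧ (w = z ∨ w = z * y)}) (by
      rintro g w ⟨z, hz, hzp, rfl | rfl⟩
      · exact ⟨_, hN.conj_mem _ hz g, by rw [conj_pow, hzp]; group, Or.inl rfl⟩
      · refine ⟨g * z * g⁻¹ * (g * y * g⁻¹ * y⁻¹), mul_mem (hN.conj_mem _ hz g) (hyc g), ?_,
          Or.inr (by group)⟩
        rw [(show Commute _ _ from hcN _ (hN.conj_mem _ hz g) _ (hyc g)).mul_pow, conj_pow, hzp,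
          mul_one, mul_inv_cancel, one_mul]
        obtain ⟨k, hk⟩ := mem_zpowers_iff.1 (hyc g)
        have h1 : (c ^ k * y) ^ p = 1 := by
          rw [hk, inv_mul_cancel_right, conj_pow, hyp]; group
        have h2 : y * c ^ k * y⁻¹ = (c ^ k) ^ s := by rw [hyx, hconj, mul_comm, zpow_mul]
        rw [mul_pow_eq_zpow_geom_sum_mul h2, hyp, mul_one, hu, ← zpow_mul, hdvd,
          ← mul_assoc] at h1
        rw [← hk, ← zpow_natCast, ← zpow_mul, hdvd]
        exact (IsCoprime.symm ⟨v, w, hvw⟩).dvd_of_dvd_mul_right h1) (by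
      rintro _ ⟨z, hz, hzp, rfl | rfl⟩ _ ⟨w, hw, hwp, rfl | rfl⟩
      · exact hcN _ hz _ hw
      · rw [← mul_assoc, hcN _ hz _ hw, mul_assoc, ← htors _ hz hzp, mul_assoc]
      · rw [mul_assoc, htors _ hw hwp, ← mul_assoc, hcN _ hz _ hw, mul_assoc]
      · rw [mul_assoc, ← mul_assoc y, htors _ hw hwp, mul_assoc w, ← mul_assoc, hcN _ hz _ hw,
          mul_assoc w y, ← mul_assoc y z, htors _ hz hzp]
        simp only [mul_assoc])
  have hcyc := h E hE hEc
  have hyE : y ∈ E := hSE ⟨1, one_mem _, one_pow _, Or.inr (one_mul y).symm⟩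
  have hz := hord p hpn
  have hzE : c ^ (n / p) ∈ E := hSE ⟨_, pow_mem (mem_zpowers c) _, by
    rw [← orderOf_dvd_iff_pow_eq_one, hz], Or.inl rfl⟩
  have := mem_zpowers_of_pow_prime_eq_one (y := (⟨y, hyE⟩ : E)) (z := ⟨_, hzE⟩) hp
    ((Subgroup.orderOf_mk _ _).trans hz) (Subtype.ext hyp)
  obtain ⟨k, hk⟩ := mem_zpowers_iff.1 this
  apply hyN
  have h3 : (c ^ (n / p)) ^ k = y := congrArg Subtype.val hk
  rw [← h3]
  exact zpow_mem (pow_mem (mem_zpowers c) _) _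

theorem conj_eq_or_eq_inv_of_pow_four_eq_one {t g : G} {s : ℤ} (ht : t ^ 4 = 1)
    (hs : g * t * g⁻¹ = t ^ s) : g * t * g⁻¹ = t ∨ g * t * g⁻¹ = t⁻¹ := by
  have hz : t ^ (4 : ℤ) = 1 := by exact_mod_cast ht
  have hmod : t ^ s = t ^ (s % 4) := by
    conv_lhs => rw [← Int.emod_add_mul_ediv s 4, zpow_add, zpow_mul, hz, one_zpow, mul_one]
  have hone : g * t * g⁻¹ = 1 → t = 1 := fun h => by simpa using h
  rw [hmod] at hs
  have h1 : s % 4 = 0 ∨ s % 4 = 1 ∨ s % 4 = 2 ∨ s % 4 = 3 := by omega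
  rcases h1 with h | h | h | h <;> rw [h] at hs
  · left; rw [hs, hone (by simpa using hs), zpow_zero]
  · left; simpa using hs
  · have h2 : g * t * g⁻¹ = t ^ 2 := by exact_mod_cast hs
    have h3 : t ^ 2 = 1 := by
      have : g * t ^ 2 * g⁻¹ = 1 := by rw [← conj_pow, h2, ← pow_mul, ht]
      simpa using this
    left
    rw [hone (h2.trans h3)]; group
  · right
    rw [hs, eq_comm, inv_eq_iff_mul_eq_one, ← zpow_one_add]
    exact hz

theorem exists_normal_comm_index_le_two [Finite G] [Group.IsNilpotent G]
    (h : ∀ N : Subgroup G, N.Normal → (∀ x ∈ N, ∀ y ∈ N, x * y = y * x) → IsCyclic N) :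
    ∃ N : Subgroup G, N.Normal ∧ (∀ x ∈ N, ∀ y ∈ N, x * y = y * x) ∧
      ∃ u : G, u * u ∈ N ∧ ∀ g : G, g ∈ N ∨ g * u⁻¹ ∈ N := by
  obtain ⟨N, hN, hNc, hC⟩ := exists_normal_comm_centralizer_le (G := G)
  have hcyc := h N hN hNc
  obtain ⟨c, rfl⟩ := (Subgroup.isCyclic_iff_exists_zpowers_eq_top N).1 hcyc
  refine ⟨_, hN, hNc, ?_⟩
  obtain ⟨t, ht, ht4, hct⟩ : ∃ t ∈ zpowers c, t ^ 4 = 1 ∧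
      (4 ∣ orderOf c → t = c ^ (orderOf c / 4)) := by
    by_cases h4 : 4 ∣ orderOf c
    · exact ⟨_, pow_mem (mem_zpowers c) _, by
        rw [← pow_mul, Nat.div_mul_cancel h4, pow_orderOf_eq_one], fun _ => rfl⟩
    · exact ⟨1, one_mem _, one_pow _, fun h => absurd h h4⟩
  have hconj : ∀ g : G, ∃ s : ℤ, g * t * g⁻¹ = t ^ s := by
    intro g
    obtain ⟨k, rfl⟩ := mem_zpowers_iff.1 ht
    obtain ⟨s, hs⟩ := mem_zpowers_iff.1 (hN.conj_mem c (mem_zpowers c) g)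
    exact ⟨s, by rw [← conj_zpow, ← hs, zpow_comm]⟩
  have htn : (zpowers t).Normal := by
    refine ⟨fun z hz g => ?_⟩
    obtain ⟨k, rfl⟩ := mem_zpowers_iff.1 hz
    obtain ⟨s, hs⟩ := hconj g
    rw [← conj_zpow, hs]
    exact zpow_mem (zpow_mem (mem_zpowers t) _) _
  have hle : centralizer (zpowers t : Set G) ≤ zpowers c := by
    by_contra hle
    obtain ⟨x, hxH, hxN, hx, p, hp, hxp⟩ := exists_prime_pow_mem_forall_commutator_mem hle
    refine hxN (mem_of_centralizes_four_torsion h hN hC hx hp hxp fun h4 => ?_)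
    rw [← hct h4]
    exact (mem_centralizer_iff.1 hxH t (mem_zpowers t)).symm
  have hmem : ∀ g : G, g * t * g⁻¹ = t → g ∈ zpowers c := by
    intro g hg
    refine hle (mem_centralizer_iff.2 fun z hz => ?_)
    obtain ⟨k, rfl⟩ := mem_zpowers_iff.1 hz
    rw [← mul_inv_eq_iff_eq_mul.1 (conj_zpow.symm.trans (congrArg (· ^ k) hg))]
  have hcase : ∀ g : G, g * t * g⁻¹ = t ∨ g * t * g⁻¹ = t⁻¹ := fun g =>
    (hconj g).elim fun s hs => conj_eq_or_eq_inv_of_pow_four_eq_one ht4 hs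
  by_cases hall : ∀ g : G, g * t * g⁻¹ = t
  · exact ⟨1, by simp, fun g => Or.inl (hmem g (hall g))⟩
  · obtain ⟨u, hu⟩ := not_forall.1 hall
    have hu' := (hcase u).resolve_left hu
    have hinv : u * t⁻¹ * u⁻¹ = t := by rw [← conj_inv, hu', inv_inv]
    refine ⟨u, hmem _ ?_, fun g => ?_⟩
    · rw [show u * u * t * (u * u)⁻¹ = u * (u * t * u⁻¹) * u⁻¹ by group, hu', hinv]
    · rcases hcase g with hg | hg
      · exact Or.inl (hmem g hg)
      · refine Or.inr (hmem _ ?_)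
        have h2 : u⁻¹ * t * u = t⁻¹ := by
          conv_lhs => rw [← hinv]
          group
        have h3 : g * t⁻¹ * g⁻¹ = t := by rw [← conj_inv, hg, inv_inv]
        rw [show g * u⁻¹ * t * (g * u⁻¹)⁻¹ = g * (u⁻¹ * t * u) * g⁻¹ by group, h2, h3]

end Group

theorem exists_idempotent_map_ne_zero {R A : Type*} [CommRing R] [IsSemisimpleRing R] [Ring A]
    [Nontrivial A] (φ : R →+* A) :
    ∃ e : R, e * e = e ∧ φ e ≠ 0 ∧ ∀ x : R, x * e = 0 ∨ ∃ y : R, y * x * e = e := by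
  obtain ⟨I, hI, hφ⟩ : ∃ I : Ideal R, IsSimpleModule R I ∧ ¬ I ≤ RingHom.ker φ := by
    by_contra! hcon
    have h1 : (⊤ : Ideal R) ≤ RingHom.ker φ := by
      rw [← IsSemisimpleModule.sSup_simples_eq_top R R]
      exact sSup_le fun I hI => hcon I hI
    exact RingHom.ker_ne_top φ (top_le_iff.1 h1)
  obtain ⟨J, hJ⟩ : ∃ J : Ideal R, IsCompl I J := ComplementedLattice.exists_isCompl I
  obtain ⟨e, he, f, hf, hef⟩ := Submodule.mem_sup.1
    (show (1 : R) ∈ I ⊔ J from hJ.sup_eq_top ▸ Submodule.mem_top)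
  have hxe : ∀ x ∈ I, x * e = x := by
    intro x hx
    have h1 : x * f ∈ I ⊓ J := ⟨I.mul_mem_right _ hx, J.mul_mem_left _ hf⟩
    rw [hJ.inf_eq_bot, Submodule.mem_bot] at h1
    linear_combination x * hef - h1
  refine ⟨e, hxe e he, fun h0 => hφ fun x hx => ?_, fun x => ?_⟩
  · rw [RingHom.mem_ker, ← hxe x hx, map_mul, h0, mul_zero]
  · by_cases hx : x * e = 0
    · exact Or.inl hx
    · right
      have hatom := isSimpleModule_iff_isAtom.1 hI
      have h1 : Ideal.span {x * e} = I := by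
        refine (hatom.le_iff.1 ?_).resolve_left ?_
        · rw [Ideal.span_singleton_le_iff_mem]; exact I.mul_mem_left _ he
        · rwa [Ideal.span_singleton_eq_bot]
      obtain ⟨y, hy⟩ := Ideal.mem_span_singleton'.1 (h1 ▸ he)
      exact ⟨y, by rw [mul_assoc, hy]⟩

theorem exists_map_mul_eq_map_of_map_mul_eq_one {R A : Type*} [CommRing R] [Ring A] (φ : R →+* A)
    {w w' d d' : R} (hw : φ (w * (d - d')) = 1) (hw' : φ (w' * (d' - d)) = 1) (k k' : R) :
    φ (w' * (k' - k)) = φ (w * (k - k')) ∧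
      φ (k' - w' * (k' - k) * d') = φ (k - w * (k - k') * d) := by
  have h1 : φ (w * (d - d') - 1) = 0 := by rw [map_sub, hw, map_one, sub_self]
  have h2 : φ (w' * (d' - d) - 1) = 0 := by rw [map_sub, hw', map_one, sub_self]
  have h3 : φ (w' + w) = 0 := by
    rw [show w' + w = -w' * (w * (d - d') - 1) + -w * (w' * (d' - d) - 1) by ring, map_add,
      map_mul, map_mul, h1, h2, mul_zero, mul_zero, add_zero]
  constructor
  · rw [← sub_eq_zero, ← map_sub,
      show w' * (k' - k) - w * (k - k') = (w' + w) * (k' - k) by ring, map_mul, h3, zero_mul]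
  · rw [← sub_eq_zero, ← map_sub,
      show k' - w' * (k' - k) * d' - (k - w * (k - k') * d) =
        (k - k') * (w * (d - d') - 1) - (w' + w) * ((k' - k) * d') by ring, map_sub, map_mul,
      map_mul, h1, h3, mul_zero, zero_mul, sub_zero]

/-- Some nonzero corner `f A f` of `A` is generated by at most four elements as a module over its
center. -/
def HasCornerOfRankLeFour (A : Type*) [Ring A] : Prop :=
  ∃ f : A, f ≠ 0 ∧ ∃ v : Fin 4 → A, ∀ x : A, ∃ c : Fin 4 → A,
    (∀ i, f * c i = c i ∧ c i * f = c i ∧ ∀ y, c i * (f * y * f) = f * y * f * c i) ∧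
    f * x * f = ∑ i, c i * v i

theorem hasCornerOfRankLeFour_of_two_generators {R A : Type*} [CommRing R] [Ring A] [Nontrivial A]
    (φ : R →+* A) (hφ : ∀ x, φ x = 0 ∨ ∃ y, φ (y * x) = 1) (U : Aˣ)
    (hU : ∀ x, ∃ x', (U : A) * φ x = φ x' * U) (hUU : ∃ t, φ t = U * U)
    (hgen : ∀ a, ∃ k l, a = φ k + φ l * U) : HasCornerOfRankLeFour A := by
  have hcomm : ∀ x y, φ x * φ y = φ y * φ x := fun x y => by rw [← map_mul, mul_comm, map_mul]
  have hcentral : ∀ x, U * φ x = φ x * U → ∀ a, φ x * a = a * φ x := by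
    intro x hx a
    obtain ⟨k, l, rfl⟩ := hgen a
    rw [mul_add, add_mul, hcomm x k, ← mul_assoc, hcomm x l, mul_assoc, mul_assoc, hx]
  suffices h : ∃ v : Fin 4 → A, ∀ x : A, ∃ c : Fin 4 → A, (∀ i y, c i * y = y * c i) ∧
      x = ∑ i, c i * v i by
    obtain ⟨v, hv⟩ := h
    refine ⟨1, one_ne_zero, v, fun x => ?_⟩
    obtain ⟨c, hc, hx⟩ := hv x
    exact ⟨c, fun i => ⟨one_mul _, mul_one _, fun y => hc i _⟩, by simpa using hx⟩
  by_cases hall : ∀ x, U * φ x = φ x * U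
  · refine ⟨![1, U, 0, 0], fun a => ?_⟩
    obtain ⟨k, l, rfl⟩ := hgen a
    refine ⟨![φ k, φ l, 0, 0], fun i y => ?_, by simp [Fin.sum_univ_four]⟩
    fin_cases i
    · exact hcentral k (hall k) y
    · exact hcentral l (hall l) y
    · simp
    · simp
  · obtain ⟨d, hd⟩ := not_forall.1 hall
    choose σ hσ using hU
    have hσσ : ∀ x, U * φ (σ x) = φ x * U := by
      intro x
      obtain ⟨t, ht⟩ := hUU
      have h1 : U * φ (σ x) * U = φ x * U * U := by
        rw [mul_assoc, ← hσ, ← mul_assoc, ← ht, hcomm, ht, mul_assoc]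
      exact U.isUnit.mul_right_cancel h1
    obtain ⟨w, hw⟩ := (hφ (d - σ d)).resolve_left fun h0 => hd (by
      rw [map_sub, sub_eq_zero] at h0
      rw [hσ, ← h0])
    have hσsub : ∀ x, U * φ (x - σ x) = φ (σ x - x) * U := fun x => by
      rw [map_sub, map_sub, mul_sub, sub_mul, hσ, hσσ]
    have hw' : φ (σ w * (σ d - d)) = 1 := by
      have h1 : (U : A) = φ (σ w * (σ d - d)) * U := by
        rw [map_mul, mul_assoc, ← hσsub, ← mul_assoc, ← hσ, mul_assoc, ← map_mul, hw, mul_one]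
      exact (U.isUnit.mul_right_cancel ((one_mul _).trans h1)).symm
    have hdecomp : ∀ k, ∃ α β, (∀ a, φ α * a = a * φ α) ∧ (∀ a, φ β * a = a * φ β) ∧
        φ k = φ α + φ β * φ d := by
      intro k
      obtain ⟨h1, h2⟩ := exists_map_mul_eq_map_of_map_mul_eq_one φ hw hw' k (σ k)
      have h3 : U * φ (w * (k - σ k)) = φ (σ w * (σ k - k)) * U := by
        rw [map_mul, ← mul_assoc, hσ, mul_assoc, hσsub, ← mul_assoc, ← map_mul]
      refine ⟨k - w * (k - σ k) * d, w * (k - σ k), hcentral _ ?_, hcentral _ ?_, ?_⟩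
      · have h4 : U * φ (k - w * (k - σ k) * d) = φ (σ k - σ w * (σ k - k) * σ d) * U := by
          rw [map_sub, mul_sub, hσ, map_mul, ← mul_assoc, h3, mul_assoc, hσ, ← mul_assoc, ← map_mul,
            ← sub_mul, ← map_sub]
        rw [h4, h2]
      · rw [h3, h1]
      · rw [map_sub, map_mul _ _ d, sub_add_cancel]
    refine ⟨![1, φ d, U, φ d * U], fun a => ?_⟩
    obtain ⟨k, l, rfl⟩ := hgen a
    obtain ⟨α, β, hα, hβ, hk⟩ := hdecomp k
    obtain ⟨γ, δ, hγ, hδ, hl⟩ := hdecomp l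
    refine ⟨![φ α, φ β, φ γ, φ δ], fun i y => ?_, ?_⟩
    · fin_cases i
      · exact hα y
      · exact hβ y
      · exact hγ y
      · exact hδ y
    · simp [Fin.sum_univ_four, hk, hl, add_mul, mul_assoc, add_assoc]

theorem exists_center_span_of_hasCornerOfRankLeFour {D : Type*} [DivisionRing D] {r : ℕ}
    (h : HasCornerOfRankLeFour (Matrix (Fin r) (Fin r) D)) :
    ∃ v : Fin 4 → D, ∀ d : D, ∃ z : Fin 4 → D, (∀ i, z i ∈ Subring.center D) ∧
      d = ∑ i, z i * v i := by
  obtain ⟨f, hf, v, hv⟩ := h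
  obtain ⟨i, j, hij⟩ : ∃ i j, f i j ≠ 0 := by
    by_contra! hcon
    exact hf (Matrix.ext hcon)
  let L : Matrix (Fin r) (Fin r) D → D := fun X => X i j * (f i j)⁻¹
  let P : D → Matrix (Fin r) (Fin r) D := fun d => Matrix.single j i ((f i j)⁻¹ * d)
  have hL : ∀ X Y d, L (X * P d * Y) = L X * d * L Y := by
    intro X Y d
    simp only [L, P, Matrix.mul_apply, Matrix.single_apply]
    rw [Finset.sum_eq_single i]
    · rw [Finset.sum_eq_single j]
      · simp [mul_assoc]
      · intro b _ hb; simp [hb.symm]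
      · simp
    · intro b _ hb
      rw [Finset.sum_eq_zero, zero_mul]
      intro a _; simp [hb.symm]
    · simp
  have hLf : L f = 1 := mul_inv_cancel₀ hij
  refine ⟨fun k => L (f * v k), fun d => ?_⟩
  obtain ⟨c, hc, hx⟩ := hv (P d)
  refine ⟨fun k => L (c k), fun k => Subring.mem_center_iff.2 fun q => ?_, ?_⟩
  · obtain ⟨h1, h2, h3⟩ := hc k
    have h4 : c k * P q * f = f * P q * c k := by
      have := h3 (P q)
      rwa [mul_assoc _ f, h1, ← mul_assoc, ← mul_assoc, h2] at this
    have h5 := congrArg L h4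
    rw [hL, hL, hLf, mul_one, one_mul] at h5
    exact h5.symm
  · have h6 : L (f * P d * f) = d := by rw [hL, hLf, one_mul, mul_one]
    rw [← h6, hx]
    have hsum : L (∑ k, c k * v k) = ∑ k, L (c k * v k) := by
      simp only [L, Matrix.sum_apply, Finset.sum_mul]
    rw [hsum]
    refine Finset.sum_congr rfl fun k _ => ?_
    obtain ⟨h1, h2, h3⟩ := hc k
    have h4 : c k * P 1 * (f * v k) = f * P 1 * (c k * v k) := by
      have := congrArg (· * v k) (h3 (P 1))
      simp only [mul_assoc] at this ⊢
      rwa [← mul_assoc (c k) f, h2, ← mul_assoc f (c k), h1] at this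
    have h5 := congrArg L h4
    rw [hL, hL, hLf, mul_one, mul_one, one_mul] at h5
    exact h5.symm

section Corner

variable {A : Type*} [Ring A] {E : A}

/-- The compression `x ↦ E * x * E` onto the corner of an idempotent. -/
def IsIdempotentElem.compress (hE : IsIdempotentElem E) : A →+ hE.Corner where
  toFun x := ⟨E * x * E, x, rfl⟩
  map_zero' := Subtype.ext (by simp; rfl)
  map_add' x y := Subtype.ext ((congrArg (· * E) (mul_add E x y)).trans (add_mul _ _ _))

theorem IsIdempotentElem.compress_val (hE : IsIdempotentElem E) (x : hE.Corner) :
    hE.compress x.1 = x := by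
  obtain ⟨h1, h2⟩ := (Subsemigroup.mem_corner_iff hE).1 x.2
  exact Subtype.ext ((congrArg (· * E) h1).trans h2)

theorem IsIdempotentElem.compress_mul (hE : IsIdempotentElem E) {x : A} (hx : x * E = E * x)
    (y : A) : hE.compress (x * y) = hE.compress x * hE.compress y := by
  refine Subtype.ext ?_
  change E * (x * y) * E = E * x * E * (E * y * E)
  simp only [← mul_assoc]
  rw [mul_assoc _ E E, hE.eq, ← hx, mul_assoc x E E, hE.eq]

/-- The algebra structure on the corner of an idempotent. -/
@[reducible]
def IsIdempotentElem.cornerAlgebra (F : Type*) [CommRing F] [Algebra F A]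
    (hE : IsIdempotentElem E) : Algebra F hE.Corner :=
  RingHom.toAlgebra'
    { __ := hE.compress.comp (algebraMap F A).toAddMonoidHom
      map_one' := Subtype.ext (show E * algebraMap F A 1 * E = E by rw [map_one, mul_one, hE.eq])
      map_mul' := fun a b => by
        change hE.compress (algebraMap F A (a * b)) = _
        rw [map_mul, hE.compress_mul (Algebra.commutes a E)]
        rfl } <| by
    intro a x
    change hE.compress (algebraMap F A a) * x = x * hE.compress (algebraMap F A a)
    obtain ⟨h1, h2⟩ := (Subsemigroup.mem_corner_iff hE).1 x.2
    rw [← hE.compress_val x, ← hE.compress_mul (Algebra.commutes a E),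
      ← hE.compress_mul (h2.trans h1.symm), Algebra.commutes]

theorem HasCornerOfRankLeFour.of_corner (hE : IsIdempotentElem E)
    (h : HasCornerOfRankLeFour hE.Corner) : HasCornerOfRankLeFour A := by
  obtain ⟨f, hf, v, hv⟩ := h
  obtain ⟨h1, h2⟩ := (Subsemigroup.mem_corner_iff hE).1 f.2
  have hfxf : ∀ x : A, (f * hE.compress x * f).1 = f.1 * x * f.1 := by
    intro x
    change f.1 * (E * x * E) * f.1 = _
    simp only [← mul_assoc]
    rw [h2, mul_assoc _ E, h1]
  refine ⟨f.1, fun h0 => hf (Subtype.ext h0), fun i => (v i).1, fun x => ?_⟩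
  obtain ⟨c, hc, hx⟩ := hv (hE.compress x)
  refine ⟨fun i => (c i).1, fun i => ⟨congrArg Subtype.val (hc i).1,
    congrArg Subtype.val (hc i).2.1, fun y => ?_⟩, ?_⟩
  · rw [← hfxf]
    exact congrArg Subtype.val ((hc i).2.2 (hE.compress y))
  · rw [← hfxf, hx]
    exact map_sum (⟨⟨Subtype.val, rfl⟩, fun _ _ => rfl⟩ : hE.Corner →+ A)
      (fun i => c i * v i) Finset.univ

end Corner

section Representation

variable {F A G : Type*} [Field F] [Ring A] [Algebra F A] [Group G] {ρ : G →* A}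

theorem forall_mul_comm_of_span_eq_top (hρ : Submodule.span F (Set.range ρ) = ⊤) {x : A}
    (hx : ∀ g, x * ρ g = ρ g * x) (a : A) : x * a = a * x := by
  have ha : a ∈ Submodule.span F (Set.range ρ) := hρ ▸ Submodule.mem_top
  induction ha using Submodule.span_induction with
  | mem a ha => obtain ⟨g, rfl⟩ := ha; exact hx g
  | zero => simp
  | add a b _ _ h1 h2 => rw [mul_add, add_mul, h1, h2]
  | smul c a _ h => rw [mul_smul_comm, smul_mul_assoc, h]

theorem exists_mul_lift_eq_lift_mul (N : Subgroup G) [N.Normal] (g : G) (x : MonoidAlgebra F N) :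
    ∃ x', ρ g * MonoidAlgebra.lift F A N (ρ.comp N.subtype) x =
      MonoidAlgebra.lift F A N (ρ.comp N.subtype) x' * ρ g := by
  induction x using MonoidAlgebra.induction_on with
  | of m =>
    refine ⟨MonoidAlgebra.of F N ⟨g * m * g⁻¹, ‹N.Normal›.conj_mem _ m.2 g⟩, ?_⟩
    simp [← map_mul]
  | add x y hx hy =>
    obtain ⟨x', hx⟩ := hx
    obtain ⟨y', hy⟩ := hy
    exact ⟨x' + y', by rw [map_add, map_add, mul_add, add_mul, hx, hy]⟩
  | smul r x hx =>
    obtain ⟨x', hx⟩ := hx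
    exact ⟨r • x', by rw [map_smul, map_smul, mul_smul_comm, smul_mul_assoc, hx]⟩

theorem hasCornerOfRankLeFour_of_index_le_two [Nontrivial A]
    (hρ : Submodule.span F (Set.range ρ) = ⊤) (N : Subgroup G) [N.Normal]
    (hN : ∀ x ∈ N, ∀ y ∈ N, x * y = y * x)
    (hfield : ∀ x, MonoidAlgebra.lift F A N (ρ.comp N.subtype) x = 0 ∨
      ∃ y, MonoidAlgebra.lift F A N (ρ.comp N.subtype) (y * x) = 1)
    {u : G} (huu : u * u ∈ N) (hu : ∀ g, g ∈ N ∨ g * u⁻¹ ∈ N) : HasCornerOfRankLeFour A := by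
  let : CommGroup N := { mul_comm := fun x y => Subtype.ext (hN x x.2 y y.2) }
  have hof (m : N) : MonoidAlgebra.lift F A N (ρ.comp N.subtype) (MonoidAlgebra.of F N m) = ρ m :=
    MonoidAlgebra.lift_of _ m
  refine hasCornerOfRankLeFour_of_two_generators
    (MonoidAlgebra.lift F A N (ρ.comp N.subtype)).toRingHom hfield (ρ.toHomUnits u)
    (exists_mul_lift_eq_lift_mul N u) ⟨MonoidAlgebra.of F N ⟨_, huu⟩, ?_⟩ fun a => ?_
  · exact (hof _).trans (map_mul ρ u u)
  · have ha : a ∈ Submodule.span F (Set.range ρ) := hρ ▸ Submodule.mem_top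
    induction ha using Submodule.span_induction with
    | mem a ha =>
      obtain ⟨g, rfl⟩ := ha
      rcases hu g with h | h
      · refine ⟨MonoidAlgebra.of F N ⟨_, h⟩, 0, ?_⟩
        rw [map_zero, zero_mul, add_zero]
        exact (hof ⟨g, h⟩).symm
      · refine ⟨0, MonoidAlgebra.of F N ⟨_, h⟩, ?_⟩
        rw [map_zero, zero_add]
        refine Eq.trans ?_ (congrArg (· * ρ u) (hof _).symm)
        change ρ g = ρ (g * u⁻¹) * ρ u
        rw [← map_mul, inv_mul_cancel_right]
    | zero => exact ⟨0, 0, by simp⟩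
    | add a b _ _ h1 h2 =>
      obtain ⟨k, l, rfl⟩ := h1
      obtain ⟨k', l', rfl⟩ := h2
      exact ⟨k + k', l + l', by rw [map_add, map_add, add_mul]; abel⟩
    | smul c a _ h =>
      obtain ⟨k, l, rfl⟩ := h
      refine ⟨c • k, c • l, ?_⟩
      rw [smul_add, ← smul_mul_assoc]
      exact congrArg₂ (· + · * _) (map_smul (MonoidAlgebra.lift F A N (ρ.comp N.subtype)) c k).symm
        (map_smul (MonoidAlgebra.lift F A N (ρ.comp N.subtype)) c l).symm

theorem isCyclic_of_lift_eq_zero_or_exists_mul_eq_one [Nontrivial A] [Finite G]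
    (hρ : Function.Injective ρ) (N : Subgroup G) (hN : ∀ x ∈ N, ∀ y ∈ N, x * y = y * x)
    (hfield : ∀ x, MonoidAlgebra.lift F A N (ρ.comp N.subtype) x = 0 ∨
      ∃ y, MonoidAlgebra.lift F A N (ρ.comp N.subtype) (y * x) = 1) : IsCyclic N := by
  let : CommGroup N := { mul_comm := fun x y => Subtype.ext (hN x x.2 y y.2) }
  have hof (m : N) : MonoidAlgebra.lift F A N (ρ.comp N.subtype) (MonoidAlgebra.of F N m) = ρ m :=
    MonoidAlgebra.lift_of _ m
  let φ : MonoidAlgebra F N →+* A := (MonoidAlgebra.lift F A N (ρ.comp N.subtype)).toRingHom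
  have hprime : (RingHom.ker φ).IsPrime := by
    refine ⟨RingHom.ker_ne_top φ, fun {x y} hxy => ?_⟩
    rw [or_iff_not_imp_right]
    intro hy
    obtain ⟨z, hz⟩ := (hfield y).resolve_left hy
    rw [RingHom.mem_ker] at hxy ⊢
    rw [← mul_one (φ x), ← (show φ (z * y) = 1 from hz), ← map_mul,
      show x * (z * y) = z * (x * y) by ring, map_mul, hxy, mul_zero]
  refine isCyclic_of_injective_ringHom (R := MonoidAlgebra F N ⧸ RingHom.ker φ)
    (f := (Ideal.Quotient.mk (RingHom.ker φ)).toMonoidHom.comp (MonoidAlgebra.of F N)) ?_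
  intro x y hxy
  have h1 : φ (MonoidAlgebra.of F N x) = φ (MonoidAlgebra.of F N y) :=
    congrArg (RingHom.kerLift φ) hxy
  exact Subtype.ext (hρ ((hof x).symm.trans (h1.trans (hof y))))

theorem exists_idempotent_of_not_field_like [Nontrivial A] [CharZero F] [Finite G]
    (hρ : Submodule.span F (Set.range ρ) = ⊤)
    (hA : ∀ a b : A, (∀ x, a * x * b = 0) → a = 0 ∨ b = 0)
    (N : Subgroup G) [N.Normal] (hN : ∀ x ∈ N, ∀ y ∈ N, x * y = y * x)
    (hfield : ¬ ∀ x, MonoidAlgebra.lift F A N (ρ.comp N.subtype) x = 0 ∨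
      ∃ y, MonoidAlgebra.lift F A N (ρ.comp N.subtype) (y * x) = 1) :
    ∃ E : A, IsIdempotentElem E ∧ E ≠ 0 ∧ (∀ g, E * ρ g = ρ g * E ∨ E * ρ g * E = 0) ∧
      ∃ g, E * ρ g ≠ ρ g * E := by
  let : CommGroup N := { mul_comm := fun x y => Subtype.ext (hN x x.2 y y.2) }
  let φ : MonoidAlgebra F N →+* A := (MonoidAlgebra.lift F A N (ρ.comp N.subtype)).toRingHom
  obtain ⟨e, he, he0, hprim⟩ := exists_idempotent_map_ne_zero φ
  have hidem : IsIdempotentElem (φ e) := by rw [IsIdempotentElem, ← map_mul, he]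
  have hcomm : ∀ x y, φ x * φ y = φ y * φ x := fun x y => by rw [← map_mul, mul_comm, map_mul]
  refine ⟨φ e, hidem, he0, fun g => ?_, ?_⟩
  · obtain ⟨e₁, h₁⟩ : ∃ e₁, ρ g * φ e = φ e₁ * ρ g := exists_mul_lift_eq_lift_mul N g e
    obtain ⟨e₂, h₂⟩ : ∃ e₂, ρ g⁻¹ * φ e = φ e₂ * ρ g⁻¹ := exists_mul_lift_eq_lift_mul N g⁻¹ e
    have h₂' : ρ g * φ e₂ = φ e * ρ g := by
      calc ρ g * φ e₂ = ρ g * (φ e₂ * ρ g⁻¹) * ρ g := by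
            rw [mul_assoc, mul_assoc, ← map_mul, inv_mul_cancel, map_one, mul_one]
        _ = φ e * ρ g := by
            rw [← h₂, ← mul_assoc, ← map_mul, mul_inv_cancel, map_one, one_mul]
    rcases hprim e₁ with h | ⟨y, hy⟩
    · right
      rw [mul_assoc, h₁, ← mul_assoc, ← map_mul, mul_comm, h, map_zero, zero_mul]
    rcases hprim e₂ with h | ⟨z, hz⟩
    · right
      rw [← h₂', mul_assoc, ← map_mul, h, map_zero, mul_zero]
    left
    have h3 : φ e * ρ g = φ y * φ e * (ρ g * φ e) := by
      conv_lhs => rw [← hy, mul_assoc, mul_comm e₁]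
      rw [h₁, map_mul, map_mul]
      simp only [mul_assoc]
    have h4 : ρ g * φ e = φ e * (ρ g * (φ z * φ e)) := by
      conv_lhs => rw [← hz, mul_comm z, mul_assoc]
      rw [map_mul, ← mul_assoc, h₂', map_mul, mul_assoc]
    have h5 : φ e * ρ g * φ e = φ e * ρ g := by
      rw [h3, mul_assoc, mul_assoc (ρ g), hidem.eq]
    rw [← h5, mul_assoc, h4, ← mul_assoc, hidem.eq]
  · by_contra! hcon
    have hcen := forall_mul_comm_of_span_eq_top hρ hcon
    rcases hA (φ e) (1 - φ e) fun x => by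
      rw [hcen, mul_assoc, mul_sub, mul_one, hidem.eq, sub_self, mul_zero] with h | h
    · exact he0 h
    · rw [sub_eq_zero] at h
      refine hfield fun x => (hprim x).imp (fun hx => ?_) fun ⟨y, hy⟩ => ⟨y, ?_⟩
      · change φ x = 0
        rw [← mul_one (φ x), h, ← map_mul, hx, map_zero]
      · change φ (y * x) = 1
        rw [← mul_one (φ _), h, ← map_mul, hy]

end Representation

theorem hasCornerOfRankLeFour_of_span_eq_top.{u, v} {F : Type*} [Field F] [CharZero F] (n : ℕ) :
    ∀ (A : Type u) [Ring A] [Algebra F A] [Nontrivial A] (G : Type v) [Group G] [Finite G]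
      [Group.IsNilpotent G] (ρ : G →* A), Nat.card G = n → Submodule.span F (Set.range ρ) = ⊤ →
      (∀ a b : A, (∀ x, a * x * b = 0) → a = 0 ∨ b = 0) → HasCornerOfRankLeFour A := by
  induction n using Nat.strong_induction_on with | h n ih
  rintro A _ _ _ G _ _ _ ρ rfl hρ hA
  by_cases hinj : Function.Injective ρ
  swap
  · refine ih (Nat.card (G ⧸ ρ.ker)) ?_ A (G ⧸ ρ.ker) (QuotientGroup.lift ρ.ker ρ le_rfl) rfl ?_ hA
    · rw [← ρ.ker.card_mul_index, ← Subgroup.index_eq_card]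
      have h1 : 1 < Nat.card ρ.ker := by
        rw [Subgroup.one_lt_card_iff_ne_bot]
        exact fun h => hinj ((MonoidHom.ker_eq_bot_iff ρ).1 h)
      exact lt_mul_of_one_lt_left (Nat.pos_of_ne_zero Subgroup.index_ne_zero_of_finite) h1
    · rw [← top_le_iff, ← hρ]
      refine Submodule.span_mono ?_
      rintro _ ⟨g, rfl⟩
      exact ⟨(g : G ⧸ ρ.ker), rfl⟩
  by_cases hall : ∀ N : Subgroup G, N.Normal → (∀ x ∈ N, ∀ y ∈ N, x * y = y * x) →
      ∀ x, MonoidAlgebra.lift F A N (ρ.comp N.subtype) x = 0 ∨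
        ∃ y, MonoidAlgebra.lift F A N (ρ.comp N.subtype) (y * x) = 1
  · obtain ⟨N, hN, hNc, u, huu, hu⟩ := exists_normal_comm_index_le_two (G := G) fun N hN hNc =>
      isCyclic_of_lift_eq_zero_or_exists_mul_eq_one hinj N hNc (hall N hN hNc)
    exact hasCornerOfRankLeFour_of_index_le_two hρ N hNc (hall N hN hNc) huu hu
  · push Not at hall
    obtain ⟨N, hN, hNc, hx⟩ := hall
    obtain ⟨E, hE, hE0, hdich, g₀, hg₀⟩ := exists_idempotent_of_not_field_like hρ hA N hNc
      (by push Not; exact hx)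
    let : Algebra F hE.Corner := hE.cornerAlgebra F
    have : Nontrivial hE.Corner := ⟨1, 0, fun h => hE0 (congrArg Subtype.val h)⟩
    let H : Subgroup G :=
      { carrier := {g | ρ g * E = E * ρ g}
        one_mem' := by simp
        mul_mem' := fun {a b} (ha : _ = _) (hb : _ = _) => by
          change ρ (a * b) * E = E * ρ (a * b)
          rw [map_mul, mul_assoc, hb, ← mul_assoc, ha, mul_assoc]
        inv_mem' := fun {a} (ha : _ = _) => by
          change ρ a⁻¹ * E = E * ρ a⁻¹
          calc ρ a⁻¹ * E = ρ a⁻¹ * (E * ρ a) * ρ a⁻¹ := by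
                rw [mul_assoc, mul_assoc, ← map_mul, mul_inv_cancel, map_one, mul_one]
            _ = E * ρ a⁻¹ := by
                rw [← ha, ← mul_assoc, ← map_mul, inv_mul_cancel, map_one, one_mul] }
    let ρ' : H →* hE.Corner :=
      { toFun := fun g => hE.compress (ρ g)
        map_one' := Subtype.ext (show E * ρ 1 * E = E by rw [map_one, mul_one, hE.eq])
        map_mul' := fun g h => by
          rw [Subgroup.coe_mul, map_mul, hE.compress_mul g.2] }
    refine HasCornerOfRankLeFour.of_corner hE
      (ih (Nat.card H) ?_ hE.Corner H ρ' rfl ?_ fun a b hab => ?_)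
    · refine lt_of_le_of_ne (Subgroup.card_le_card_group H) fun hcard => hg₀ ?_
      have hg : g₀ ∈ H := (Subgroup.card_eq_iff_eq_top H).1 hcard ▸ Subgroup.mem_top g₀
      exact hg.symm
    · refine top_le_iff.1 fun x _ => ?_
      suffices hcompress : ∀ a : A, hE.compress a ∈ Submodule.span F (Set.range ρ') from
        hE.compress_val x ▸ hcompress x.1
      intro a
      have ha : a ∈ Submodule.span F (Set.range ρ) := hρ ▸ Submodule.mem_top
      induction ha using Submodule.span_induction with
      | mem a ha =>
        obtain ⟨g, rfl⟩ := ha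
        rcases hdich g with h | h
        · exact Submodule.subset_span ⟨⟨g, h.symm⟩, rfl⟩
        · have h0 : hE.compress (ρ g) = 0 := Subtype.ext h
          rw [h0]; exact zero_mem _
      | zero => rw [map_zero]; exact zero_mem _
      | add a b _ _ h1 h2 => rw [map_add]; exact add_mem h1 h2
      | smul c a _ h =>
        rw [Algebra.smul_def, hE.compress_mul (Algebra.commutes c E)]
        exact (Algebra.smul_def (A := hE.Corner) c _) ▸ Submodule.smul_mem _ c h
    · obtain ⟨h1, h2⟩ := (Subsemigroup.mem_corner_iff hE).1 a.2
      obtain ⟨h3, h4⟩ := (Subsemigroup.mem_corner_iff hE).1 b.2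
      refine (hA a.1 b.1 fun x => ?_).imp Subtype.ext Subtype.ext
      have h5 : a.1 * (E * x * E) * b.1 = 0 := congrArg Subtype.val (hab (hE.compress x))
      simp only [← mul_assoc] at h5
      rwa [h2, mul_assoc _ E, h3] at h5

theorem Matrix.eq_zero_or_eq_zero_of_forall_mul_mul_eq_zero {n D : Type*} [Fintype n]
    [DecidableEq n] [DivisionRing D] (a b : Matrix n n D) (h : ∀ x, a * x * b = 0) :
    a = 0 ∨ b = 0 := by
  by_contra! hab
  obtain ⟨i, j, hij⟩ : ∃ i j, a i j ≠ 0 := by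
    by_contra! hcon
    exact hab.1 (Matrix.ext hcon)
  obtain ⟨k, l, hkl⟩ : ∃ k l, b k l ≠ 0 := by
    by_contra! hcon
    exact hab.2 (Matrix.ext hcon)
  have h1 := congrFun (congrFun (h (Matrix.single j k 1)) i) l
  rw [Matrix.mul_assoc, Matrix.mul_apply, Finset.sum_eq_single j, Matrix.single_mul_apply_same,
    one_mul] at h1
  · exact mul_ne_zero hij hkl h1
  · intro x _ hx
    rw [Matrix.single_mul_apply_of_ne _ _ _ _ _ hx, mul_zero]
  · simp

theorem nontrivial_simpleComponent {R : Type*} [Ring R] {e : R}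
    (he : IsCentrallyPrimitiveIdempotent R e) : Nontrivial (simpleComponent R e) := by
  obtain ⟨hc, hidem, he0, -⟩ := he
  rw [Subring.mem_center_iff] at hc
  refine ⟨1, 0, fun h => he0 ?_⟩
  have h1 : (1 : R) ∈ TwoSidedIdeal.span {1 - e} := by
    rw [TwoSidedIdeal.mem_iff]
    exact (RingCon.eq _).1 h
  suffices h2 : ∀ x ∈ TwoSidedIdeal.span {1 - e}, e * x = 0 by
    rw [← mul_one e, h2 1 h1]
  intro x hx
  induction hx using TwoSidedIdeal.span_induction with
  | mem x hx => rw [Set.mem_singleton_iff.1 hx, mul_sub, mul_one, hidem, sub_self]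
  | zero => exact mul_zero e
  | add x y _ _ hx hy => rw [mul_add, hx, hy, add_zero]
  | neg x _ hx => rw [mul_neg, hx, neg_zero]
  | left_absorb a x _ hx => rw [← mul_assoc, ← hc, mul_assoc, hx, mul_zero]
  | right_absorb b x _ hx => rw [← mul_assoc, hx, zero_mul]

theorem hasCornerOfRankLeFour_of_surjective {F A G : Type*} [Field F] [CharZero F] [Ring A]
    [Nontrivial A] [Group G] [Finite G] [Group.IsNilpotent G] (f : MonoidAlgebra F G →+* A)
    (hf : Function.Surjective f) (hA : ∀ a b : A, (∀ x, a * x * b = 0) → a = 0 ∨ b = 0) :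
    HasCornerOfRankLeFour A := by
  let : Algebra F A := RingHom.toAlgebra' (f.comp (algebraMap F (MonoidAlgebra F G))) fun c x => by
    obtain ⟨x, rfl⟩ := hf x
    rw [RingHom.comp_apply, ← map_mul, ← map_mul, Algebra.commutes]
  refine hasCornerOfRankLeFour_of_span_eq_top (F := F) _ A G
    (f.toMonoidHom.comp (MonoidAlgebra.of F G)) rfl ((Submodule.eq_top_iff').2 fun x => ?_) hA
  obtain ⟨x, rfl⟩ := hf x
  induction x using MonoidAlgebra.induction_on with
  | of g => exact Submodule.subset_span ⟨g, rfl⟩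
  | add x y hx hy => rw [map_add]; exact add_mem hx hy
  | smul c x hx =>
    rw [Algebra.smul_def, map_mul]
    exact Algebra.smul_def (A := A) c _ ▸ Submodule.smul_mem _ c hx

theorem finrank_le_four_of_hasCornerOfRankLeFour {Z D : Type*} [Field Z] [DivisionRing D]
    [Algebra Z D] (hZ : Set.range (algebraMap Z D) = (Subring.center D : Set D)) {r : ℕ}
    (h : HasCornerOfRankLeFour (Matrix (Fin r) (Fin r) D)) : Module.finrank Z D ≤ 4 := by
  obtain ⟨v, hv⟩ := exists_center_span_of_hasCornerOfRankLeFour h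
  have hspan : Submodule.span Z (Set.range v) = ⊤ := by
    refine top_le_iff.1 fun d _ => ?_
    obtain ⟨z, hz, rfl⟩ := hv d
    refine Submodule.sum_mem _ fun i _ => ?_
    obtain ⟨c, hc⟩ : z i ∈ Set.range (algebraMap Z D) := hZ ▸ hz i
    rw [← hc, ← Algebra.smul_def]
    exact Submodule.smul_mem _ _ (Submodule.subset_span ⟨i, rfl⟩)
  rw [← finrank_top Z D, ← hspan]
  exact (finrank_range_le_card v).trans (by simp)

theorem schur_stmt16
    (F : Type) [Field F] [NumberField F] [IsGalois ℚ F]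
    (hab : ∀ g h : F ≃ₐ[ℚ] F, g * h = h * g)
    (G : Type) [Group G] [Fintype G] [Group.IsNilpotent G]
    (e : MonoidAlgebra F G) (he : IsCentrallyPrimitiveIdempotent (MonoidAlgebra F G) e)
    (D : Type) [DivisionRing D]
    (Z : Type) [Field Z] [Algebra Z D] [FiniteDimensional Z D]
    (hZ : Set.range (algebraMap Z D) = (Subring.center D : Set D))
    (r : ℕ)
    (hD : Nonempty (simpleComponent (MonoidAlgebra F G) e ≃+* Matrix (Fin r) (Fin r) D))
    (m : ℕ) (hm : m * m = Module.finrank Z D) (hm1 : 1 < m) :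
    m = 2 ∧ Module.finrank Z D = 4 := by
  obtain ⟨ε⟩ := hD
  have := nontrivial_simpleComponent he
  have : Nontrivial (Matrix (Fin r) (Fin r) D) := ε.injective.nontrivial
  have h4 := finrank_le_four_of_hasCornerOfRankLeFour hZ (hasCornerOfRankLeFour_of_surjective
    (ε.toRingHom.comp (TwoSidedIdeal.span {1 - e}).ringCon.mk')
    (ε.surjective.comp (RingCon.mk'_surjective _))
    Matrix.eq_zero_or_eq_zero_of_forall_mul_mul_eq_zero)
  obtain rfl : m = 2 := by nlinarith
  exact ⟨rfl, hm.symm⟩
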